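/- Let H be a real Hilbert space, let A : H → Set H be maximally monotone, let β > 0, L > 0, let B₁ : H → H be β-cocoercive, let B₂ : H → H be monotone and L-Lipschitzian, let X ⊆ H be a nonempty closed convex set with X ⊆ dom A, and let B₃ : H → H satisfy ⟪a − b, B₃a − B₃b⟫ ≥ 0 for all a, b ∈ dom A, be continuous on dom A, and be uniformly continuous on every subset of closure(convexHull(dom A)) that is compact in the weak topology of H. Assume the operator x ↦ {u + B₃x : u ∈ A x} is maximally monotone and that Z := {w ∈ X : −(B₁w + B₂w + B₃w) ∈ A w} is nonempty. Write B = B₁ + B₂ + B₃. Let ε ∈ (0,1), ρ = min{2βε, √(1−ε)/L}, σ ∈ (0,1), θ ∈ (0, √(1−ε) − Lρσ). Let sequences (zₙ), (xₙ) in H and (γₙ) in ℝ satisfy: z₀ ∈ X; for every n, γₙ ∈ {ρσᵏ : k ∈ ℕ, k ≥ 1}, zₙ − γₙ B zₙ − xₙ ∈ γₙ • A xₙ, γₙ‖B₃zₙ − B₃xₙ‖ ≤ θ‖zₙ − xₙ‖, zₙ₊₁ is the metric projection of xₙ + γₙ((B₂zₙ + B₃zₙ) − (B₂xₙ + B₃xₙ))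 onto X, and moreover γₙ is maximal in the sense that whenever γₙ < ρσ, the point x'ₙ satisfying zₙ − (γₙ/σ) B zₙ − x'ₙ ∈ (γₙ/σ) • A x'ₙ fulfils (γₙ/σ)‖B₃zₙ − B₃x'ₙ‖ > θ‖zₙ − x'ₙ‖. Then there exists z̄ ∈ Z such that (zₙ) converges weakly to z̄. -/

import Mathlib

open scoped Pointwise RealInnerProductSpace
open Filter Topology

section WeakCompactness

variable {H : Type*} [NormedAddCommGroup H] [InnerProductSpace ℝ H] [CompleteSpace H]

theorem isCompact_toWeakSpace_closedBall (r : ℝ) :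
    IsCompact (toWeakSpace ℝ H '' Metric.closedBall 0 r) := by
  let g : WeakDual ℝ H → WeakSpace ℝ H :=
    fun f => toWeakSpace ℝ H ((InnerProductSpace.toDual ℝ H).symm (WeakDual.toStrongDual f))
  have hg : Continuous g := by
    refine WeakBilin.continuous_of_continuous_eval _ fun f => ?_
    refine (WeakDual.eval_continuous ((InnerProductSpace.toDual ℝ H).symm f)).congr fun x => ?_
    change x _ = f ((InnerProductSpace.toDual ℝ H).symm (WeakDual.toStrongDual x))
    rw [← InnerProductSpace.toDual_symm_apply (𝕜 := ℝ) (y := f), real_inner_comm,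
      InnerProductSpace.toDual_symm_apply]
    rfl
  refine ((WeakDual.isCompact_closedBall (𝕜 := ℝ) (E := H) 0 r).image hg).of_isClosed_subset ?_ ?_
  · have h := (convex_closedBall (0 : H) r).toWeakSpace_closure ℝ
    rw [Metric.isClosed_closedBall.closure_eq] at h
    rw [h]
    exact isClosed_closure
  · rintro _ ⟨x, hx, rfl⟩
    refine ⟨StrongDual.toWeakDual (InnerProductSpace.toDual ℝ H x), ?_, ?_⟩
    · simpa using hx
    · simp [g]

theorem Convex.isCompact_toWeakSpace_inter_closedBall {C : Set H} (hC : Convex ℝ C)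
    (hCcl : IsClosed C) (r : ℝ) :
    IsCompact (toWeakSpace ℝ H '' (C ∩ Metric.closedBall 0 r)) := by
  refine (isCompact_toWeakSpace_closedBall r).of_isClosed_subset ?_
    (Set.image_mono Set.inter_subset_right)
  have h := (hC.inter (convex_closedBall (0 : H) r)).toWeakSpace_closure ℝ
  rw [(hCcl.inter Metric.isClosed_closedBall).closure_eq] at h
  rw [h]
  exact isClosed_closure

/-- A bounded family in a closed convex set has a weak limit in this set along any ultrafilter. -/
theorem Convex.exists_weak_limit_ultrafilter {C : Set H} (hC : Convex ℝ C) (hCcl : IsClosed C)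
    {ι : Type*} (U : Ultrafilter ι) {z : ι → H} {r : ℝ} (hz : ∀ i, z i ∈ C)
    (hr : ∀ i, ‖z i‖ ≤ r) :
    ∃ p ∈ C, ∀ w : H, Tendsto (fun i => ⟪z i, w⟫) U (𝓝 ⟪p, w⟫) := by
  obtain ⟨_, ⟨p, hp, rfl⟩, hle⟩ :=
    (hC.isCompact_toWeakSpace_inter_closedBall hCcl r).ultrafilter_le_nhds
      (U.map fun i => toWeakSpace ℝ H (z i)) (by
        refine le_principal_iff.2 (Filter.mem_map.2 (Filter.univ_mem' fun i => ?_))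
        exact ⟨z i, ⟨hz i, by simpa using hr i⟩, rfl⟩)
  refine ⟨p, hp.1, fun w => ?_⟩
  have hcont : Continuous fun x : WeakSpace ℝ H => innerSL ℝ w ((toWeakSpace ℝ H).symm x) :=
    WeakBilin.eval_continuous (topDualPairing ℝ H).flip (innerSL ℝ w)
  have := (hcont.tendsto (toWeakSpace ℝ H p)).comp (f := fun i => toWeakSpace ℝ H (z i)) hle
  simpa [Function.comp_def, real_inner_comm] using this

end WeakCompactness

section Minty

/-- The function `(p, t) ↦ t + ‖p‖ ^ 2 / 2` attains its infimum on a closed convex set where it is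
bounded below; the conclusion is the first-order optimality condition. -/
theorem exists_forall_add_inner_le {E : Type*} [NormedAddCommGroup E] [InnerProductSpace ℝ E]
    [CompleteSpace E] {K : Set (E × ℝ)} (hK : Convex ℝ K) (hKcl : IsClosed K) (hne : K.Nonempty)
    {c : ℝ} (hc : ∀ q ∈ K, c ≤ q.2 + ‖q.1‖ ^ 2 / 2) :
    ∃ p ∈ K, ∀ q ∈ K, p.2 + ⟪p.1, p.1⟫ ≤ q.2 + ⟪p.1, q.1⟫ := by
  set φ : E × ℝ → ℝ := fun q => q.2 + ‖q.1‖ ^ 2 / 2 with hφ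
  set m := sInf (φ '' K)
  have hm : ∀ q ∈ K, m ≤ φ q := fun q hq =>
    csInf_le ⟨c, by rintro _ ⟨q, hq, rfl⟩; exact hc q hq⟩ ⟨q, hq, rfl⟩
  have hex : ∀ n : ℕ, ∃ q ∈ K, φ q < m + 1 / ((n : ℝ) + 1) := fun n => by
    obtain ⟨_, ⟨q, hq, rfl⟩, h⟩ := exists_lt_of_csInf_lt (hne.image φ)
      (lt_add_of_pos_right m (Nat.one_div_pos_of_nat (α := ℝ) (n := n)))
    exact ⟨q, hq, h⟩
  choose q hq hqm using hex
  have hcauchy : CauchySeq fun n => (q n).1 := by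
    refine cauchySeq_of_le_tendsto_0' (fun n : ℕ => Real.sqrt (8 * (1 / ((n : ℝ) + 1)))) ?_ ?_
    · intro n k hnk
      refine Real.le_sqrt_of_sq_le ?_
      have hmid := hm _ (hK (hq n) (hq k) (by norm_num : (0 : ℝ) ≤ 1 / 2)
        (by norm_num : (0 : ℝ) ≤ 1 / 2) (by norm_num))
      have hk := hqm k
      have hn := hqm n
      have hle := Nat.one_div_le_one_div (α := ℝ) hnk
      simp only [hφ, Prod.fst_add, Prod.snd_add, Prod.smul_fst, Prod.smul_snd, smul_eq_mul,
        ← smul_add, norm_smul, mul_pow] at hmid hk hn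
      have hpar := parallelogram_law_with_norm ℝ (q n).1 (q k).1
      rw [dist_eq_norm]
      norm_num at hmid
      nlinarith
    · have : Tendsto (fun n : ℕ => Real.sqrt (8 * (1 / ((n : ℝ) + 1)))) atTop
          (𝓝 (Real.sqrt (8 * 0))) :=
        (Real.continuous_sqrt.tendsto _).comp (tendsto_one_div_add_atTop_nhds_zero_nat.const_mul 8)
      simpa using this
  obtain ⟨p, hp⟩ := cauchySeq_tendsto_of_complete hcauchy
  have hφm : Tendsto (fun n => φ (q n)) atTop (𝓝 m) := by
    refine tendsto_of_tendsto_of_tendsto_of_le_of_le tendsto_const_nhds ?_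
      (fun n => hm _ (hq n)) (fun n => (hqm n).le)
    simpa using (tendsto_one_div_add_atTop_nhds_zero_nat (𝕜 := ℝ)).const_add m
  have ht : Tendsto (fun n => (q n).2) atTop (𝓝 (m - ‖p‖ ^ 2 / 2)) :=
    (hφm.sub ((hp.norm.pow 2).div_const 2)).congr fun n => by simp [hφ]
  have hpK : (p, m - ‖p‖ ^ 2 / 2) ∈ K :=
    hKcl.mem_of_tendsto (hp.prodMk_nhds ht) (Eventually.of_forall hq)
  refine ⟨_, hpK, fun r hr => ?_⟩
  have hs : ∀ s ∈ Set.Ioo (0 : ℝ) 1,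
      0 ≤ (r.2 - (m - ‖p‖ ^ 2 / 2) + ⟪p, r.1 - p⟫) + s * (‖r.1 - p‖ ^ 2 / 2) := by
    intro s hs
    have h := hm _ (hK hpK hr (sub_nonneg.2 hs.2.le) hs.1.le (by ring))
    have hpt : (1 - s) • p + s • r.1 = p + s • (r.1 - p) := by module
    simp only [hφ, Prod.fst_add, Prod.snd_add, Prod.smul_fst, Prod.smul_snd, smul_eq_mul, hpt] at h
    rw [norm_add_sq_real, real_inner_smul_right, norm_smul, Real.norm_of_nonneg hs.1.le] at h
    refine nonneg_of_mul_nonneg_right ?_ hs.1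
    nlinarith
  have hlim : Tendsto (fun s : ℝ => (r.2 - (m - ‖p‖ ^ 2 / 2) + ⟪p, r.1 - p⟫)
      + s * (‖r.1 - p‖ ^ 2 / 2)) (𝓝[>] 0)
      (𝓝 ((r.2 - (m - ‖p‖ ^ 2 / 2) + ⟪p, r.1 - p⟫) + 0 * (‖r.1 - p‖ ^ 2 / 2))) :=
    (Continuous.tendsto (by fun_prop) 0).mono_left nhdsWithin_le_nhds
  have := ge_of_tendsto hlim (by
    filter_upwards [Ioo_mem_nhdsGT (zero_lt_one' ℝ)] with s h using hs s h)
  rw [inner_sub_right] at this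
  simp only
  linarith

variable {H : Type*} [NormedAddCommGroup H] [InnerProductSpace ℝ H]

/-- A set-valued operator is maximally monotone if its graph is a maximal monotone set. -/
def IsMaximallyMonotone (A : H → Set H) : Prop :=
  (∀ x u y v, u ∈ A x → v ∈ A y → 0 ≤ ⟪x - y, u - v⟫) ∧
    ∀ x u, (∀ y v, v ∈ A y → 0 ≤ ⟪x - y, u - v⟫) → u ∈ A x

namespace IsMaximallyMonotone

variable {A : H → Set H}

theorem exists_neg_mem [CompleteSpace H] (hA : IsMaximallyMonotone A) : ∃ x, -x ∈ A x := by
  let K : Set (WithLp 2 (H × H) × ℝ) :=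
    {q | ∀ y v, v ∈ A y → ⟪y, q.1.snd⟫ + ⟪q.1.fst, v⟫ - ⟪y, v⟫ ≤ q.2}
  have hKcl : IsClosed K := by
    simp only [K, Set.ofPred_forall]
    refine isClosed_iInter fun y => isClosed_iInter fun v => isClosed_iInter fun _ =>
      isClosed_le ?_ ?_ <;> fun_prop
  have hK : Convex ℝ K := by
    intro a ha b hb s t hs ht hst y v hv
    have h₁ := mul_le_mul_of_nonneg_left (ha y v hv) hs
    have h₂ := mul_le_mul_of_nonneg_left (hb y v hv) ht
    simp only [Prod.fst_add, Prod.snd_add, Prod.smul_fst, Prod.smul_snd, WithLp.add_fst,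
      WithLp.add_snd, WithLp.smul_fst, WithLp.smul_snd, inner_add_left, inner_add_right,
      real_inner_smul_left, real_inner_smul_right, smul_eq_mul]
    have : ⟪y, v⟫ = s * ⟪y, v⟫ + t * ⟪y, v⟫ := by rw [← add_mul, hst, one_mul]
    linarith
  have hgra : ∀ y v, v ∈ A y → ((WithLp.toLp 2 (y, v), ⟪y, v⟫) : WithLp 2 (H × H) × ℝ) ∈ K := by
    intro y v hv y' v' hv'
    have := hA.1 y v y' v' hv hv'
    simp only [inner_sub_left, inner_sub_right] at this
    change ⟪y', v⟫ + ⟪y, v'⟫ - ⟪y', v'⟫ ≤ ⟪y, v⟫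
    linarith
  have hF : ∀ q ∈ K, ⟪q.1.fst, q.1.snd⟫ ≤ q.2 := by
    intro q hq
    by_contra! hlt
    have hmem : q.1.snd ∈ A q.1.fst := hA.2 _ _ fun y v hv => by
      have := hq y v hv
      simp only [inner_sub_left, inner_sub_right]
      linarith
    have := hq _ _ hmem
    linarith
  have hne : K.Nonempty := by
    by_cases h : ∃ y v, v ∈ A y
    · obtain ⟨y, v, hv⟩ := h
      exact ⟨_, hgra y v hv⟩
    · push Not at h
      exact ⟨0, fun y v hv => (h y v hv).elim⟩
  obtain ⟨⟨p, t⟩, hp, hopt⟩ := exists_forall_add_inner_le hK hKcl hne (c := 0) fun q hq => by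
    have h₁ := hF q hq
    have h₂ := norm_add_sq_real q.1.fst q.1.snd
    rw [WithLp.prod_norm_sq_eq_of_L2]
    nlinarith [sq_nonneg ‖q.1.fst + q.1.snd‖]
  have ht := hF _ hp
  have key : ∀ y v, v ∈ A y → ‖p.fst + p.snd‖ ^ 2 ≤ ⟪-p.snd - y, -p.fst - v⟫ := by
    intro y v hv
    have := hopt _ (hgra y v hv)
    simp only [WithLp.prod_inner_apply] at this ht
    rw [norm_add_sq_real, ← real_inner_self_eq_norm_sq, ← real_inner_self_eq_norm_sq]
    simp only [inner_sub_left, inner_sub_right, inner_neg_left, inner_neg_right]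
    have e₁ := real_inner_comm p.fst p.snd
    have e₂ := real_inner_comm p.fst y
    simp only [WithLp.fst, WithLp.snd] at *
    linarith
  have hmem : -p.fst ∈ A (-p.snd) := hA.2 _ _ fun y v hv => (sq_nonneg _).trans (key y v hv)
  have h0 := key _ _ hmem
  rw [sub_self, inner_zero_left] at h0
  have : p.fst + p.snd = 0 := by
    rw [← norm_eq_zero]
    exact pow_eq_zero_iff two_ne_zero |>.1 (le_antisymm h0 (sq_nonneg _))
  refine ⟨-p.snd, ?_⟩
  rwa [eq_neg_of_add_eq_zero_left this] at hmem

/-- **Minty's theorem**: resolvents of maximally monotone operators have full domain. -/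
theorem exists_resolvent [CompleteSpace H] (hA : IsMaximallyMonotone A) {γ : ℝ} (hγ : 0 < γ)
    (w : H) : ∃ x, w - x ∈ γ • A x := by
  have hB : IsMaximallyMonotone fun x => {u | γ⁻¹ • (u + w) ∈ A x} := by
    refine ⟨fun x u y v hu hv => ?_, fun x u h => hA.2 _ _ fun y v hv => ?_⟩
    · have := hA.1 _ _ _ _ hu hv
      rw [← smul_sub, real_inner_smul_right, add_sub_add_right_eq_sub] at this
      exact nonneg_of_mul_nonneg_right this (inv_pos.2 hγ)
    · have := h y (γ • v - w) (by
        change γ⁻¹ • (γ • v - w + w) ∈ A y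
        rwa [sub_add_cancel, inv_smul_smul₀ hγ.ne'])
      have e : γ⁻¹ • (u + w) - v = γ⁻¹ • (u - (γ • v - w)) := by
        rw [eq_inv_smul_iff₀ hγ.ne', smul_sub, smul_inv_smul₀ hγ.ne']
        module
      rw [e, real_inner_smul_right]
      positivity
  obtain ⟨x, hx⟩ := hB.exists_neg_mem
  refine ⟨x, _, hx, ?_⟩
  simp only [smul_inv_smul₀ hγ.ne']
  abel

/-- If `-(D x)` is monotonically related in the sense of `A + D` then `-(D x) ∈ A x`, for `D`
Lipschitzian. -/
theorem neg_mem_of_lipschitz [CompleteSpace H] (hA : IsMaximallyMonotone A) {D : H → H} {M : ℝ}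
    (hM : 0 < M) (hD : ∀ a b, ‖D a - D b‖ ≤ M * ‖a - b‖) {x : H}
    (h : ∀ y v, v ∈ A y → 0 ≤ ⟪x - y, -(v + D y)⟫) : -D x ∈ A x := by
  set c := (2 * M)⁻¹ with hc
  have hc0 : 0 < c := by positivity
  obtain ⟨y, v, hv, hvy⟩ := hA.exists_resolvent hc0 (x - c • D x)
  have hvy : c • v = x - c • D x - y := hvy
  have h₁ := h y v hv
  have e : c • -(v + D y) = c • (D x - D y) - (x - y) := by
    rw [smul_neg, smul_add, hvy]; module
  have h₂ : 0 ≤ ⟪x - y, c • -(v + D y)⟫ := by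
    rw [real_inner_smul_right]; positivity
  rw [e, inner_sub_right, real_inner_smul_right, real_inner_self_eq_norm_sq] at h₂
  have h₃ : ⟪x - y, D x - D y⟫ ≤ ‖x - y‖ * (M * ‖x - y‖) :=
    (real_inner_le_norm _ _).trans (mul_le_mul_of_nonneg_left (hD x y) (norm_nonneg _))
  have h₄ : c * ⟪x - y, D x - D y⟫ ≤ ‖x - y‖ ^ 2 / 2 := by
    calc c * ⟪x - y, D x - D y⟫ ≤ c * (‖x - y‖ * (M * ‖x - y‖)) := by gcongr
      _ = ‖x - y‖ ^ 2 / 2 := by rw [hc]; field_simp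
  have hxy : x - y = 0 := by
    rw [← norm_eq_zero]
    exact pow_eq_zero_iff two_ne_zero |>.1 (le_antisymm (by linarith) (sq_nonneg _))
  obtain rfl := sub_eq_zero.1 hxy
  have : v = -D x := by
    apply smul_right_injective H hc0.ne'
    simp only [hvy]; module
  exact this ▸ hv


/-- Demiclosedness of the sum of a maximally monotone operator and a monotone Lipschitzian one. -/
theorem neg_mem_of_tendsto [CompleteSpace H] (hA : IsMaximallyMonotone A) {D : H → H} {M : ℝ}
    (hM : 0 < M) (hD : ∀ a b, ‖D a - D b‖ ≤ M * ‖a - b‖) (hDmono : ∀ a b, 0 ≤ ⟪a - b, D a - D b⟫)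
    {ι : Type*} {l : Filter ι} [l.NeBot] {x u : ι → H} {p : H} {R : ℝ} (hu : ∀ i, u i ∈ A (x i))
    (hR : ∀ᶠ i in l, ‖x i‖ ≤ R) (hx : ∀ w, Tendsto (fun i => ⟪x i, w⟫) l (𝓝 ⟪p, w⟫))
    (hr : Tendsto (fun i => u i + D (x i)) l (𝓝 0)) : -D p ∈ A p := by
  refine hA.neg_mem_of_lipschitz hM hD fun y v hv => ?_
  have h₁ : Tendsto (fun i => ⟪x i - y, u i + D (x i)⟫) l (𝓝 0) := by
    refine squeeze_zero_norm' (a := fun i => (R + ‖y‖) * ‖u i + D (x i)‖) ?_ ?_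
    · filter_upwards [hR] with i hi
      refine (norm_inner_le_norm _ _).trans ?_
      gcongr
      exact (norm_sub_le _ _).trans (by gcongr)
    · simpa using hr.norm.const_mul (R + ‖y‖)
  have h₂ : Tendsto (fun i => ⟪x i - y, u i + D (x i)⟫ - (⟪x i, v + D y⟫ - ⟪y, v + D y⟫)) l
      (𝓝 (0 - (⟪p, v + D y⟫ - ⟪y, v + D y⟫))) :=
    h₁.sub ((hx _).sub_const _)
  have h₃ := ge_of_tendsto' h₂ (b := 0) fun i => by
    have a₁ := hA.1 _ _ _ _ (hu i) hv
    have a₂ := hDmono (x i) y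
    rw [← inner_sub_left, ← inner_sub_right]
    have e : u i + D (x i) - (v + D y) = (u i - v) + (D (x i) - D y) := by abel
    rw [e, inner_add_right]
    exact add_nonneg a₁ a₂
  rw [inner_neg_right, inner_sub_left]
  linarith

end IsMaximallyMonotone

end Minty

section ForwardBackward

variable {H : Type*} [NormedAddCommGroup H] [InnerProductSpace ℝ H]

/-- **Opial's lemma** for Fejér monotone sequences in a closed convex set. -/
theorem exists_weak_limit_of_fejer [CompleteSpace H] {X Z : Set H} (hX : Convex ℝ X)
    (hXcl : IsClosed X) (hZ : Z.Nonempty) {z : ℕ → H} (hz : ∀ n, z n ∈ X)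
    (hfejer : ∀ p ∈ Z, ∀ n, ‖z (n + 1) - p‖ ≤ ‖z n - p‖)
    (hcluster : ∀ U : Ultrafilter ℕ, (U : Filter ℕ) ≤ atTop → ∀ p ∈ X,
      (∀ w : H, Tendsto (fun n => ⟪z n, w⟫) U (𝓝 ⟪p, w⟫)) → p ∈ Z) :
    ∃ p ∈ Z, ∀ w : H, Tendsto (fun n => ⟪z n, w⟫) atTop (𝓝 ⟪p, w⟫) := by
  have hanti : ∀ p ∈ Z, Antitone fun n => ‖z n - p‖ := fun p hp =>
    antitone_nat_of_succ_le (hfejer p hp)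
  obtain ⟨p₀, hp₀⟩ := hZ
  have hbdd : ∀ n, ‖z n‖ ≤ ‖z 0 - p₀‖ + ‖p₀‖ := fun n => by
    have h₁ := hanti p₀ hp₀ (Nat.zero_le n)
    have h₂ := norm_add_le (z n - p₀) p₀
    rw [sub_add_cancel] at h₂
    simp only at h₁
    linarith
  have hlim : ∀ U : Ultrafilter ℕ, (U : Filter ℕ) ≤ atTop → ∃ p ∈ Z,
      ∀ w : H, Tendsto (fun n => ⟪z n, w⟫) U (𝓝 ⟪p, w⟫) := fun U hU => by
    obtain ⟨p, hp, h⟩ := hX.exists_weak_limit_ultrafilter hXcl U hz hbdd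
    exact ⟨p, hcluster U hU p hp h, h⟩
  have hconv : ∀ p ∈ Z, ∃ l, Tendsto (fun n => ‖z n - p‖) atTop (𝓝 l) := fun p hp =>
    ⟨_, tendsto_atTop_ciInf (hanti p hp) ⟨0, by rintro _ ⟨n, rfl⟩; exact norm_nonneg _⟩⟩
  obtain ⟨p, hp, hpU⟩ := hlim (Ultrafilter.of atTop) (Ultrafilter.of_le atTop)
  refine ⟨p, hp, fun w => tendsto_iff_ultrafilter _ _ _ |>.2 fun U hU => ?_⟩
  obtain ⟨q, hq, hqU⟩ := hlim U hU
  obtain ⟨a, ha⟩ := hconv p hp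
  obtain ⟨b, hb⟩ := hconv q hq
  have hpq : Tendsto (fun n => ⟪z n, p - q⟫) atTop
      (𝓝 ((b ^ 2 - a ^ 2 + (‖p‖ ^ 2 - ‖q‖ ^ 2)) / 2)) := by
    refine ((((hb.pow 2).sub (ha.pow 2)).add_const (‖p‖ ^ 2 - ‖q‖ ^ 2)).div_const 2).congr
      fun n => ?_
    rw [norm_sub_sq_real, norm_sub_sq_real, inner_sub_right]
    ring
  have e₁ := tendsto_nhds_unique (hpU (p - q)) (hpq.mono_left (Ultrafilter.of_le atTop))
  have e₂ := tendsto_nhds_unique (hqU (p - q)) (hpq.mono_left hU)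
  have : p - q = 0 := by
    rw [← inner_self_eq_zero (𝕜 := ℝ), inner_sub_left, e₁, e₂, sub_self]
  rw [sub_eq_zero.1 this]
  exact hqU w

theorem norm_sub_le_of_inner_le_zero {y q c : H} (h : ⟪y - q, c - q⟫ ≤ 0) :
    ‖q - c‖ ≤ ‖y - c‖ := by
  refine (pow_le_pow_iff_left₀ (norm_nonneg _) (norm_nonneg _) two_ne_zero).1 ?_
  have e : y - c = (y - q) - (c - q) := by abel
  rw [norm_sub_rev q c, e, norm_sub_sq_real (y - q)]
  nlinarith [sq_nonneg ‖y - q‖]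

/-- The scaled displacement `‖z - J_{γA} (z - γ b)‖ / γ` is nonincreasing in `γ`. -/
theorem norm_le_of_resolvent_le {A : H → Set H}
    (hA : ∀ x u y v, u ∈ A x → v ∈ A y → 0 ≤ ⟪x - y, u - v⟫) {γ γ' : ℝ} (hγ : 0 < γ)
    (hγγ' : γ ≤ γ') {z b e e' : H} (he : e - b ∈ A (z - γ • e)) (he' : e' - b ∈ A (z - γ' • e')) :
    ‖e'‖ ≤ ‖e‖ := by
  have h := hA _ _ _ _ he he'
  have h₁ : z - γ • e - (z - γ' • e') = γ' • e' - γ • e := by abel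
  rw [h₁, sub_sub_sub_cancel_right, inner_sub_left, inner_sub_right, inner_sub_right] at h
  simp only [real_inner_smul_left, real_inner_self_eq_norm_sq, real_inner_comm e e'] at h
  have h₂ := real_inner_le_norm e' e
  by_contra! hlt
  have h₃ : (γ + γ') * ⟪e', e⟫ ≤ (γ + γ') * (‖e'‖ * ‖e‖) :=
    mul_le_mul_of_nonneg_left h₂ (by linarith)
  have h₄ : γ * ‖e‖ < γ' * ‖e'‖ :=
    (mul_lt_mul_of_pos_left hlt hγ).trans_le (by gcongr)
  nlinarith [mul_pos (sub_pos.2 h₄) (sub_pos.2 hlt), real_inner_comm e e']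

theorem inv_smul_sub_mem_of_resolvent {A : H → Set H} {γ : ℝ} (hγ : γ ≠ 0) {z b x : H}
    (h : z - γ • b - x ∈ γ • A x) : γ⁻¹ • (z - x) - b ∈ A x := by
  obtain ⟨u, hu, h⟩ := h
  have h : γ • u = z - γ • b - x := h
  have e : γ⁻¹ • (z - x) - b = u := by
    apply smul_right_injective H hγ
    simp only [h, smul_sub, smul_inv_smul₀ hγ]
    abel
  rwa [e]

/-- One step of the forward-backward-half-forward iteration, before projecting. -/
theorem norm_sub_sq_le_of_cocoercive {β γ ε κ : ℝ} (hε : 0 < ε) (hγ : 0 ≤ γ)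
    (hγβ : γ ≤ 2 * β * ε) {x y z p d : H} (hxy : ‖x - y‖ ≤ κ * ‖z - x‖)
    (hd : β * ‖d‖ ^ 2 ≤ ⟪z - p, d⟫) (hmono : γ * ⟪x - p, d⟫ ≤ ⟪x - p, z - y⟫) :
    ‖y - p‖ ^ 2 ≤ ‖z - p‖ ^ 2 - (1 - ε - κ ^ 2) * ‖z - x‖ ^ 2 := by
  have e₁ : y - p = (x - p) - (x - y) := by abel
  have e₂ : z - p = (x - p) + (z - x) := by abel
  have e₃ : z - y = (z - x) + (x - y) := by abel
  rw [e₂, inner_add_left] at hd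
  rw [e₃, inner_add_right] at hmono
  rw [e₁, e₂, norm_sub_sq_real, norm_add_sq_real]
  have h₁ : ‖x - y‖ ^ 2 ≤ κ ^ 2 * ‖z - x‖ ^ 2 := by
    rw [← mul_pow]; exact pow_le_pow_left₀ (norm_nonneg _) hxy 2
  have h₂ := real_inner_le_norm (z - x) d
  have h₃ : γ * (β * ‖d‖ ^ 2) ≤ γ * (⟪x - p, d⟫ + ‖z - x‖ * ‖d‖) := by gcongr; linarith
  have h₄ : 2 * γ * (‖z - x‖ * ‖d‖) ≤ ε * ‖z - x‖ ^ 2 + 2 * γ * β * ‖d‖ ^ 2 := by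
    have h₅ : γ ^ 2 * ‖d‖ ^ 2 ≤ ε * (2 * γ * β * ‖d‖ ^ 2) := by
      have := mul_le_mul_of_nonneg_left hγβ (mul_nonneg hγ (sq_nonneg ‖d‖))
      linarith
    refine le_of_mul_le_mul_left ?_ hε
    nlinarith [sq_nonneg (ε * ‖z - x‖ - γ * ‖d‖)]
  linarith

end ForwardBackward

/-- Weak convergence of the forward–backward–half-forward method with the
Armijo-type backtracking line search, when `B₃` is uniformly continuous on
weakly compact subsets of `closure (convexHull (dom A))` and `X ⊆ dom A`. -/
theorem stmt_9 {H : Type*} [NormedAddCommGroup H] [InnerProductSpace ℝ H]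
    [CompleteSpace H]
    (A : H → Set H)
    (hAmono : ∀ a u b v, u ∈ A a → v ∈ A b → 0 ≤ ⟪a - b, u - v⟫)
    (hAmax : ∀ a u, (∀ b v, v ∈ A b → 0 ≤ ⟪a - b, u - v⟫) → u ∈ A a)
    (β L : ℝ) (hβ : 0 < β) (hL : 0 < L)
    (B₁ B₂ B₃ : H → H)
    (hB₁ : ∀ a b : H, β * ‖B₁ a - B₁ b‖ ^ 2 ≤ ⟪a - b, B₁ a - B₁ b⟫)
    (hB₂mono : ∀ a b : H, 0 ≤ ⟪a - b, B₂ a - B₂ b⟫)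
    (hB₂lip : ∀ a b : H, ‖B₂ a - B₂ b‖ ≤ L * ‖a - b‖)
    (X : Set H) (hXne : X.Nonempty) (hXcl : IsClosed X) (hXconv : Convex ℝ X)
    (hXdom : X ⊆ {w : H | (A w).Nonempty})
    (hB₃mono : ∀ a ∈ {w : H | (A w).Nonempty}, ∀ b ∈ {w : H | (A w).Nonempty},
      0 ≤ ⟪a - b, B₃ a - B₃ b⟫)
    (hB₃cont : ContinuousOn B₃ {w : H | (A w).Nonempty})
    (hB₃unif : ∀ S : Set H, S ⊆ closure (convexHull ℝ {w : H | (A w).Nonempty}) →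
      IsCompact (toWeakSpace ℝ H '' S) →
      ∀ ε > (0 : ℝ), ∃ δ > (0 : ℝ), ∀ a ∈ S, ∀ b ∈ S,
        ‖a - b‖ < δ → ‖B₃ a - B₃ b‖ < ε)
    (hsum_mono : ∀ a u b v, u ∈ A a → v ∈ A b →
      0 ≤ ⟪a - b, (u + B₃ a) - (v + B₃ b)⟫)
    (hsum_max : ∀ a u, (∀ b v, v ∈ A b → 0 ≤ ⟪a - b, u - (v + B₃ b)⟫) →
      u - B₃ a ∈ A a)
    (hZne : ∃ w ∈ X, -(B₁ w + B₂ w + B₃ w) ∈ A w)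
    (ε : ℝ) (hε : ε ∈ Set.Ioo (0 : ℝ) 1)
    (ρ : ℝ) (hρ : ρ = min (2 * β * ε) (Real.sqrt (1 - ε) / L))
    (σ : ℝ) (hσ : σ ∈ Set.Ioo (0 : ℝ) 1)
    (θ : ℝ) (hθ : θ ∈ Set.Ioo (0 : ℝ) (Real.sqrt (1 - ε) - L * ρ * σ))
    (zseq xseq : ℕ → H) (γseq : ℕ → ℝ)
    (hz0 : zseq 0 ∈ X)
    (hγ : ∀ n, ∃ k : ℕ, 1 ≤ k ∧ γseq n = ρ * σ ^ k)
    (hres : ∀ n, zseq n - γseq n • (B₁ (zseq n) + B₂ (zseq n) + B₃ (zseq n))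
      - xseq n ∈ γseq n • A (xseq n))
    (hls : ∀ n, γseq n * ‖B₃ (zseq n) - B₃ (xseq n)‖ ≤ θ * ‖zseq n - xseq n‖)
    (hprojX : ∀ n, zseq (n + 1) ∈ X)
    (hproj : ∀ n, ∀ c ∈ X,
      ⟪xseq n + γseq n • ((B₂ (zseq n) + B₃ (zseq n)) - (B₂ (xseq n) + B₃ (xseq n)))
        - zseq (n + 1), c - zseq (n + 1)⟫ ≤ 0)
    (hmaximal : ∀ n, γseq n < ρ * σ → ∀ x' : H,
      zseq n - (γseq n / σ) • (B₁ (zseq n) + B₂ (zseq n) + B₃ (zseq n)) - x'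
        ∈ (γseq n / σ) • A x' →
      θ * ‖zseq n - x'‖ < (γseq n / σ) * ‖B₃ (zseq n) - B₃ x'‖) :
    ∃ zbar, zbar ∈ X ∧ -(B₁ zbar + B₂ zbar + B₃ zbar) ∈ A zbar ∧
      ∀ w : H, Filter.Tendsto (fun n => ⟪zseq n, w⟫) Filter.atTop (nhds ⟪zbar, w⟫) := by
  obtain ⟨hε0, hε1⟩ := hε
  obtain ⟨hσ0, hσ1⟩ := hσ
  obtain ⟨hθ0, hθ1⟩ := hθ
  set κ := L * ρ * σ + θ with hκ
  have hρ0 : 0 < ρ := by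
    rw [hρ]
    have : 0 < Real.sqrt (1 - ε) := Real.sqrt_pos.2 (by linarith)
    positivity
  have hρσ : 0 < ρ * σ := mul_pos hρ0 hσ0
  have hγ0 : ∀ n, 0 < γseq n := fun n => by
    obtain ⟨k, -, hk⟩ := hγ n
    rw [hk]; positivity
  have hγle : ∀ n, γseq n ≤ ρ * σ := fun n => by
    obtain ⟨k, hk1, hk⟩ := hγ n
    rw [hk]
    gcongr
    exact pow_le_of_le_one hσ0.le hσ1.le (by lia)
  have hγβ : ∀ n, γseq n ≤ 2 * β * ε := fun n =>
    (hγle n).trans ((mul_le_of_le_one_right hρ0.le hσ1.le).trans (hρ.trans_le (min_le_left _ _)))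
  have hκ1 : 0 < 1 - ε - κ ^ 2 := by
    have h₁ : κ < Real.sqrt (1 - ε) := by linarith
    have h₂ := (Real.lt_sqrt (by positivity)).1 h₁
    linarith
  have hA : IsMaximallyMonotone A := ⟨hAmono, hAmax⟩
  have hz : ∀ n, zseq n ∈ X := fun n => by
    cases n with
    | zero => exact hz0
    | succ n => exact hprojX n
  have hu : ∀ n, (γseq n)⁻¹ • (zseq n - xseq n) - (B₁ (zseq n) + B₂ (zseq n) + B₃ (zseq n))
      ∈ A (xseq n) := fun n => inv_smul_sub_mem_of_resolvent (hγ0 n).ne' (hres n)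
  let Z : Set H := {w | w ∈ X ∧ -(B₁ w + B₂ w + B₃ w) ∈ A w}
  have hstep : ∀ p ∈ Z, ∀ n, ‖zseq (n + 1) - p‖ ^ 2 ≤
      ‖zseq n - p‖ ^ 2 - (1 - ε - κ ^ 2) * ‖zseq n - xseq n‖ ^ 2 := by
    intro p hp n
    have hproj' := norm_sub_le_of_inner_le_zero (hproj n p hp.1)
    refine (pow_le_pow_left₀ (norm_nonneg _) hproj' 2).trans ?_
    refine norm_sub_sq_le_of_cocoercive hε0 (hγ0 n).le (hγβ n) ?_ (hB₁ (zseq n) p) ?_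
    · have e : ∀ a b : H, a - (a + b) = -b := fun a b => by abel
      rw [e, norm_neg, add_sub_add_comm, smul_add]
      refine (norm_add_le _ _).trans ?_
      rw [norm_smul, norm_smul, Real.norm_of_nonneg (hγ0 n).le, hκ, add_mul]
      refine add_le_add ?_ (hls n)
      calc γseq n * ‖B₂ (zseq n) - B₂ (xseq n)‖
          ≤ ρ * σ * (L * ‖zseq n - xseq n‖) := by
            gcongr
            exacts [hγle n, hB₂lip _ _]
        _ = L * ρ * σ * ‖zseq n - xseq n‖ := by ring
    · have h₁ := add_nonneg (hsum_mono _ _ _ _ (hu n) hp.2) (hB₂mono (xseq n) p)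
      rw [← inner_add_right] at h₁
      have h₂ := mul_nonneg (hγ0 n).le h₁
      rw [← real_inner_smul_right] at h₂
      rw [← real_inner_smul_right, ← sub_nonneg, ← inner_sub_right]
      refine h₂.trans_eq (congrArg _ ?_)
      simp only [smul_add, smul_sub, smul_neg, smul_inv_smul₀ (hγ0 n).ne']
      abel
  have hfejer : ∀ p ∈ Z, ∀ n, ‖zseq (n + 1) - p‖ ≤ ‖zseq n - p‖ := fun p hp n => by
    refine (pow_le_pow_iff_left₀ (norm_nonneg _) (norm_nonneg _) two_ne_zero).1 ?_
    have := hstep p hp n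
    have : 0 ≤ (1 - ε - κ ^ 2) * ‖zseq n - xseq n‖ ^ 2 := by positivity
    linarith
  obtain ⟨p₀, hp₀⟩ : Z.Nonempty := hZne
  have hzx : Tendsto (fun n => ‖zseq n - xseq n‖) atTop (𝓝 0) := by
    have hanti : Antitone fun n => ‖zseq n - p₀‖ ^ 2 :=
      antitone_nat_of_succ_le fun n => pow_le_pow_left₀ (norm_nonneg _) (hfejer p₀ hp₀ n) 2
    have hl := tendsto_atTop_ciInf hanti ⟨0, by rintro _ ⟨n, rfl⟩; positivity⟩
    have hdiff := (hl.sub (hl.comp (tendsto_add_atTop_nat 1))).div_const (1 - ε - κ ^ 2)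
    rw [sub_self, zero_div] at hdiff
    have hsq : Tendsto (fun n => ‖zseq n - xseq n‖ ^ 2) atTop (𝓝 0) :=
      squeeze_zero (fun n => sq_nonneg _) (fun n => by
        rw [le_div_iff₀ hκ1]
        have := hstep p₀ hp₀ n
        simp only [Function.comp_apply]
        linarith) hdiff
    simpa [Real.sqrt_sq] using hsq.sqrt
  obtain ⟨R, hR⟩ : ∃ R, ∀ n, ‖zseq n‖ ≤ R := by
    refine ⟨‖zseq 0 - p₀‖ + ‖p₀‖, fun n => ?_⟩
    have h₁ := antitone_nat_of_succ_le (f := fun n => ‖zseq n - p₀‖) (hfejer p₀ hp₀) (Nat.zero_le n)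
    have h₂ := norm_add_le (zseq n - p₀) p₀
    rw [sub_add_cancel] at h₂
    linarith
  -- points of the graph of `A`, close to `zseq n`, for which the step size does not degenerate
  have hex : ∀ n, ∃ x f : H, f - (B₁ (zseq n) + B₂ (zseq n) + B₃ (zseq n)) ∈ A x ∧
      ‖zseq n - x‖ ≤ σ⁻¹ * ‖zseq n - xseq n‖ ∧
      ‖f‖ ≤ (ρ * σ)⁻¹ * ‖zseq n - xseq n‖ + θ⁻¹ * ‖B₃ (zseq n) - B₃ x‖ := by
    intro n
    rcases (hγle n).eq_or_lt with h | h
    · refine ⟨xseq n, _, hu n, ?_, ?_⟩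
      · exact le_mul_of_one_le_left (norm_nonneg _) (one_le_inv_iff₀.2 ⟨hσ0, hσ1.le⟩)
      · rw [h, norm_smul, norm_inv, Real.norm_of_nonneg hρσ.le]
        exact le_add_of_nonneg_right (by positivity)
    · have hγ' : 0 < γseq n / σ := div_pos (hγ0 n) hσ0
      obtain ⟨x, hx⟩ := hA.exists_resolvent hγ'
        (zseq n - (γseq n / σ) • (B₁ (zseq n) + B₂ (zseq n) + B₃ (zseq n)))
      have hux := inv_smul_sub_mem_of_resolvent hγ'.ne' hx
      have hmax := hmaximal n h x hx
      refine ⟨x, _, hux, ?_, ?_⟩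
      · have hle := norm_le_of_resolvent_le hAmono (hγ0 n)
          (le_div_self (hγ0 n).le hσ0 hσ1.le) (z := zseq n)
          (b := B₁ (zseq n) + B₂ (zseq n) + B₃ (zseq n))
          (e := (γseq n)⁻¹ • (zseq n - xseq n)) (e' := (γseq n / σ)⁻¹ • (zseq n - x))
          (by simpa only [smul_inv_smul₀ (hγ0 n).ne', sub_sub_cancel] using hu n)
          (by simpa only [smul_inv_smul₀ hγ'.ne', sub_sub_cancel] using hux)
        rw [norm_smul, norm_smul, norm_inv, norm_inv, Real.norm_of_nonneg hγ'.le,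
          Real.norm_of_nonneg (hγ0 n).le, inv_mul_le_iff₀ hγ'] at hle
        refine hle.trans_eq ?_
        field_simp [(hγ0 n).ne']
      · rw [norm_smul, norm_inv, Real.norm_of_nonneg hγ'.le]
        refine le_add_of_nonneg_of_le (by positivity) ?_
        rw [inv_mul_le_iff₀ hγ', mul_left_comm, le_inv_mul_iff₀ hθ0]
        exact hmax.le
  choose x f hxf hzx' hf using hex
  have hdist : Tendsto (fun n => ‖zseq n - x n‖) atTop (𝓝 0) :=
    squeeze_zero (fun n => norm_nonneg _) hzx' (by simpa using hzx.const_mul σ⁻¹)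
  have hxR : ∀ᶠ n in atTop, ‖x n‖ ≤ R + 1 := by
    filter_upwards [hdist.eventually_le_const zero_lt_one] with n hn
    have h := norm_sub_norm_le (x n) (zseq n)
    rw [norm_sub_rev] at h
    linarith [hR n]
  have hB₃lim : Tendsto (fun n => ‖B₃ (zseq n) - B₃ (x n)‖) atTop (𝓝 0) := by
    refine Metric.tendsto_nhds.2 fun η hη => ?_
    obtain ⟨δ, hδ, huc⟩ := hB₃unif _ Set.inter_subset_left
      ((convex_convexHull ℝ {w : H | (A w).Nonempty}).closure.isCompact_toWeakSpace_inter_closedBall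
        isClosed_closure (R + 1)) η hη
    have hsub : {w : H | (A w).Nonempty} ⊆ closure (convexHull ℝ {w : H | (A w).Nonempty}) :=
      (subset_convexHull ℝ _).trans subset_closure
    filter_upwards [hdist.eventually_lt_const hδ, hxR] with n hn hxn
    simpa using huc _ ⟨hsub (hXdom (hz n)), by simpa using (hR n).trans (by linarith)⟩
      _ ⟨hsub ⟨_, hxf n⟩, by simpa using hxn⟩ hn
  have hflim : Tendsto f atTop (𝓝 0) :=
    squeeze_zero_norm hf (by simpa using (hzx.const_mul (ρ * σ)⁻¹).add (hB₃lim.const_mul θ⁻¹))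
  have hC : IsMaximallyMonotone fun y => {v | v - B₃ y ∈ A y} := by
    refine ⟨fun a u b v hu hv => ?_, fun a u h => hsum_max a u fun b v hv => h b _ ?_⟩
    · simpa using hsum_mono a _ b _ hu hv
    · simpa using hv
  set M := β⁻¹ + L with hM
  have hDlip : ∀ a b, ‖(B₁ a + B₂ a) - (B₁ b + B₂ b)‖ ≤ M * ‖a - b‖ := fun a b => by
    have h₁ : ‖B₁ a - B₁ b‖ ≤ β⁻¹ * ‖a - b‖ := by
      rw [le_inv_mul_iff₀ hβ]
      rcases (norm_nonneg (B₁ a - B₁ b)).eq_or_lt with h | h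
      · simp [← h]
      · refine le_of_mul_le_mul_right ?_ h
        have := (hB₁ a b).trans (real_inner_le_norm _ _)
        linarith
    rw [add_sub_add_comm, hM, add_mul]
    exact (norm_add_le _ _).trans (add_le_add h₁ (hB₂lip a b))
  have hDmono : ∀ a b, 0 ≤ ⟪a - b, (B₁ a + B₂ a) - (B₁ b + B₂ b)⟫ := fun a b => by
    rw [add_sub_add_comm, inner_add_right]
    exact add_nonneg (le_trans (by positivity) (hB₁ a b)) (hB₂mono a b)
  have hDlim : Tendsto (fun n => (B₁ (x n) + B₂ (x n)) - (B₁ (zseq n) + B₂ (zseq n))) atTop (𝓝 0) :=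
    squeeze_zero_norm (fun n => hDlip _ _) (by simpa [norm_sub_rev] using hdist.const_mul M)
  have hres0 : Tendsto (fun n => (f n - (B₁ (zseq n) + B₂ (zseq n) + B₃ (zseq n)) + B₃ (x n))
      + (B₁ (x n) + B₂ (x n))) atTop (𝓝 0) := by
    have h := (hflim.add hDlim).sub (tendsto_zero_iff_norm_tendsto_zero.2 hB₃lim)
    simp only [add_zero, sub_zero] at h
    refine h.congr fun n => by abel
  obtain ⟨p, hp, hlim⟩ := exists_weak_limit_of_fejer hXconv hXcl ⟨p₀, hp₀⟩ hz hfejer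
    fun U hU p hpX hpU => by
      refine ⟨hpX, ?_⟩
      have hxU : ∀ w, Tendsto (fun n => ⟪x n, w⟫) U (𝓝 ⟪p, w⟫) := fun w => by
        have h0 : Tendsto (fun n => ⟪zseq n - x n, w⟫) U (𝓝 ⟪(0 : H), w⟫) :=
          ((tendsto_zero_iff_norm_tendsto_zero.2 hdist).mono_left hU).inner tendsto_const_nhds
        have := (hpU w).sub h0
        simpa [inner_sub_left] using this
      have := hC.neg_mem_of_tendsto (by positivity) hDlip hDmono
        (fun n => (by simpa using hxf n : f n - (B₁ (zseq n) + B₂ (zseq n) + B₃ (zseq n)) + B₃ (x n)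
          ∈ {v | v - B₃ (x n) ∈ A (x n)})) (hxR.filter_mono hU) hxU (hres0.mono_left hU)
      rw [neg_add _ (B₃ p), ← sub_eq_add_neg]
      exact this
  exact ⟨p, hp.1, hp.2, hlim⟩
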